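/- Let λ : ℝ² → ℝ be a positive smooth function and let g = λ·g^st be the 2-Riemannian metric on ℝ² given by g_p(u,v/w) = λ(p)·g^st(u,v/w). Then a smooth vector field X on ℝ² is stationary with respect to g if and only if 2·div(X) + X(ln λ) = 0 identically on ℝ². -/

import Mathlib

open scoped RealInnerProductSpace

noncomputable section

/-- The simple 2-Riemannian metric `g^st` on `ℝ²` induced by the Euclidean inner
product. -/
def gst2 (u v w : EuclideanSpace ℝ (Fin 2)) : ℝ :=
  ⟪u, v⟫ * ⟪w, w⟫ - ⟪u, w⟫ * ⟪v, w⟫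

/-- The action `X(f)(p) = Df_p(X(p))` of a vector field `X` on `ℝ²` on a function. -/
def vfApply (X : EuclideanSpace ℝ (Fin 2) → EuclideanSpace ℝ (Fin 2))
    (f : EuclideanSpace ℝ (Fin 2) → ℝ) (p : EuclideanSpace ℝ (Fin 2)) : ℝ :=
  fderiv ℝ f p (X p)

/-- The Lie bracket `[X,Y](p) = DY_p(X(p)) − DX_p(Y(p))` of vector fields on `ℝ²`. -/
def lieB (X Y : EuclideanSpace ℝ (Fin 2) → EuclideanSpace ℝ (Fin 2))
    (p : EuclideanSpace ℝ (Fin 2)) : EuclideanSpace ℝ (Fin 2) :=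
  fderiv ℝ Y p (X p) - fderiv ℝ X p (Y p)

/-- The divergence `div X = ∂X₁/∂x + ∂X₂/∂y` of a vector field on `ℝ²`. -/
def divVF (X : EuclideanSpace ℝ (Fin 2) → EuclideanSpace ℝ (Fin 2))
    (p : EuclideanSpace ℝ (Fin 2)) : ℝ :=
  ∑ i : Fin 2, fderiv ℝ X p (EuclideanSpace.single i 1) i

/-- A smooth vector field `X` on `ℝ²` is stationary with respect to the 2-Riemannian
metric `g = λ·g^st`: `X(g(Y,Z/X)) = g([X,Y],Z/X) + g(Y,[X,Z]/X)` for all smooth vector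
fields `Y`, `Z`. -/
def StationaryFor (lam : EuclideanSpace ℝ (Fin 2) → ℝ)
    (X : EuclideanSpace ℝ (Fin 2) → EuclideanSpace ℝ (Fin 2)) : Prop :=
  ∀ Y Z : EuclideanSpace ℝ (Fin 2) → EuclideanSpace ℝ (Fin 2),
    ContDiff ℝ (⊤ : ℕ∞) Y → ContDiff ℝ (⊤ : ℕ∞) Z →
    ∀ p : EuclideanSpace ℝ (Fin 2),
      vfApply X (fun q => lam q * gst2 (Y q) (Z q) (X q)) p =
        lam p * gst2 (lieB X Y p) (Z p) (X p) + lam p * gst2 (Y p) (lieB X Z p) (X p)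

/-- The planar cross product `u₀ w₁ - u₁ w₀`. -/
def planeCross (u w : EuclideanSpace ℝ (Fin 2)) : ℝ :=
  u 0 * w 1 - u 1 * w 0

lemma gst2_eq_planeCross_mul (u v w : EuclideanSpace ℝ (Fin 2)) :
    gst2 u v w = planeCross u w * planeCross v w := by
  simp only [gst2, planeCross, PiLp.inner_apply, Fin.sum_univ_two, RCLike.inner_apply, conj_trivial]
  ring

lemma planeCross_sub_left (u v w : EuclideanSpace ℝ (Fin 2)) :
    planeCross (u - v) w = planeCross u w - planeCross v w := by
  simp only [planeCross, PiLp.sub_apply]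
  ring

/-- A linear endomorphism of the plane acts on the cross product, as a derivation, by its trace. -/
lemma planeCross_map_left_add_map_right
    (A : EuclideanSpace ℝ (Fin 2) →L[ℝ] EuclideanSpace ℝ (Fin 2))
    (u w : EuclideanSpace ℝ (Fin 2)) :
    planeCross (A u) w + planeCross u (A w) =
      (∑ i : Fin 2, A (EuclideanSpace.single i 1) i) * planeCross u w := by
  have hA (v : EuclideanSpace ℝ (Fin 2)) (j : Fin 2) :
      A v j = v 0 * A (EuclideanSpace.single 0 1) j + v 1 * A (EuclideanSpace.single 1 1) j := by
    have hv : v = v 0 • EuclideanSpace.single (0 : Fin 2) (1 : ℝ) +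
        v 1 • EuclideanSpace.single (1 : Fin 2) (1 : ℝ) := by
      ext i
      fin_cases i <;> simp
    conv_lhs => rw [hv]
    simp
  simp only [planeCross, Fin.sum_univ_two, hA u, hA w]
  ring

lemma exists_planeCross_ne_zero {w : EuclideanSpace ℝ (Fin 2)} (hw : w ≠ 0) :
    ∃ u, planeCross u w ≠ 0 := by
  by_contra! h
  apply hw
  have h0 := h (EuclideanSpace.single 0 1)
  have h1 := h (EuclideanSpace.single 1 1)
  ext i
  fin_cases i <;> simp_all [planeCross]

lemma differentiableAt_planeCross_and_fderiv {U W : EuclideanSpace ℝ (Fin 2) → EuclideanSpace ℝ (Fin 2)}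
    {p : EuclideanSpace ℝ (Fin 2)} (hU : DifferentiableAt ℝ U p) (hW : DifferentiableAt ℝ W p) :
    DifferentiableAt ℝ (fun q => planeCross (U q) (W q)) p ∧
      ∀ v, fderiv ℝ (fun q => planeCross (U q) (W q)) p v =
        planeCross (fderiv ℝ U p v) (W p) + planeCross (U p) (fderiv ℝ W p v) := by
  have hcoord {V : EuclideanSpace ℝ (Fin 2) → EuclideanSpace ℝ (Fin 2)}
      (hV : DifferentiableAt ℝ V p) (i : Fin 2) :=
    (EuclideanSpace.proj i : EuclideanSpace ℝ (Fin 2) →L[ℝ] ℝ).hasFDerivAt.comp p hV.hasFDerivAt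
  have h := ((hcoord hU 0).mul (hcoord hW 1)).sub ((hcoord hU 1).mul (hcoord hW 0))
  refine ⟨h.differentiableAt, fun v => ?_⟩
  refine (congrArg (fun L => L v) h.fderiv).trans ?_
  simp [planeCross]
  ring

/-- The defect of stationarity is `λ (2 div X + X(ln λ))` times a product of cross products. -/
lemma vfApply_mul_gst2_sub {lam : EuclideanSpace ℝ (Fin 2) → ℝ}
    {X Y Z : EuclideanSpace ℝ (Fin 2) → EuclideanSpace ℝ (Fin 2)} {p : EuclideanSpace ℝ (Fin 2)}
    (hlam : DifferentiableAt ℝ lam p) (hp : lam p ≠ 0) (hX : DifferentiableAt ℝ X p)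
    (hY : DifferentiableAt ℝ Y p) (hZ : DifferentiableAt ℝ Z p) :
    vfApply X (fun q => lam q * gst2 (Y q) (Z q) (X q)) p -
        (lam p * gst2 (lieB X Y p) (Z p) (X p) + lam p * gst2 (Y p) (lieB X Z p) (X p)) =
      lam p * (2 * divVF X p + vfApply X (fun q => Real.log (lam q)) p) *
        (planeCross (Y p) (X p) * planeCross (Z p) (X p)) := by
  obtain ⟨dY, hY'⟩ := differentiableAt_planeCross_and_fderiv hY hX
  obtain ⟨dZ, hZ'⟩ := differentiableAt_planeCross_and_fderiv hZ hX
  have traceY := planeCross_map_left_add_map_right (fderiv ℝ X p) (Y p) (X p)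
  have traceZ := planeCross_map_left_add_map_right (fderiv ℝ X p) (Z p) (X p)
  have hprod := (hlam.hasFDerivAt.mul (dY.hasFDerivAt.mul dZ.hasFDerivAt)).fderiv
  have hderiv := congrArg (fun L => L (X p)) hprod
  simp only [Pi.mul_def, add_apply, smul_apply, smul_eq_mul,
    hY', hZ'] at hderiv
  simp only [vfApply, gst2_eq_planeCross_mul, lieB, planeCross_sub_left, divVF, hderiv,
    fderiv.log hlam hp, smul_apply, smul_eq_mul]
  field_simp
  linear_combination lam p * planeCross (Z p) (X p) * traceY +
    lam p * planeCross (Y p) (X p) * traceZ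

lemma continuous_two_mul_divVF_add {lam : EuclideanSpace ℝ (Fin 2) → ℝ}
    {X : EuclideanSpace ℝ (Fin 2) → EuclideanSpace ℝ (Fin 2)}
    (hlam : ContDiff ℝ 1 lam) (hpos : ∀ p, lam p ≠ 0) (hX : ContDiff ℝ 1 X) :
    Continuous fun p => 2 * divVF X p + vfApply X (fun q => Real.log (lam q)) p := by
  have hdX : Continuous (fderiv ℝ X) := hX.continuous_fderiv one_ne_zero
  have hdlog : Continuous (fderiv ℝ fun q => Real.log (lam q)) :=
    (hlam.log hpos).continuous_fderiv one_ne_zero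
  have hXc := hX.continuous
  unfold divVF vfApply
  fun_prop

/-- Theorem 9 of the paper: for `g = λ·g^st` a 2-Riemannian metric on `ℝ²` conformally
equivalent to `g^st`, a smooth vector field `X` is stationary with respect to `g` if
and only if `2·div(X) + X(ln λ) = 0` identically. -/
theorem stationary_iff_div_eq
    (lam : EuclideanSpace ℝ (Fin 2) → ℝ)
    (hlam : ContDiff ℝ (⊤ : ℕ∞) lam) (hlampos : ∀ p, 0 < lam p)
    (X : EuclideanSpace ℝ (Fin 2) → EuclideanSpace ℝ (Fin 2))
    (hX : ContDiff ℝ (⊤ : ℕ∞) X) :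
    StationaryFor lam X ↔
      ∀ p : EuclideanSpace ℝ (Fin 2),
        2 * divVF X p + vfApply X (fun q => Real.log (lam q)) p = 0 := by
  have hne (p) : lam p ≠ 0 := (hlampos p).ne'
  have hlam' : Differentiable ℝ lam := hlam.differentiable (by simp)
  have hX' : Differentiable ℝ X := hX.differentiable (by simp)
  constructor
  · intro h
    have hclosed : IsClosed
        {p | 2 * divVF X p + vfApply X (fun q => Real.log (lam q)) p = 0} :=
      isClosed_eq (continuous_two_mul_divVF_add (hlam.of_le (by simp)) hne (hX.of_le (by simp)))
        continuous_const
    have hsupport : Function.support X ⊆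
        {p | 2 * divVF X p + vfApply X (fun q => Real.log (lam q)) p = 0} := by
      intro p hp
      obtain ⟨u, hu⟩ := exists_planeCross_ne_zero hp
      have hdefect := vfApply_mul_gst2_sub (Y := fun _ => u) (Z := fun _ => u) (hlam' p) (hne p)
        (hX' p) (differentiableAt_const u) (differentiableAt_const u)
      rw [sub_eq_zero.mpr (h _ _ contDiff_const contDiff_const p)] at hdefect
      simpa [hne p, hu] using hdefect.symm
    intro p
    by_cases hp : p ∈ tsupport X
    · exact closure_minimal hsupport hclosed hp
    · have hzero := notMem_tsupport_iff_eventuallyEq.mp hp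
      have hfderiv : fderiv ℝ X p = 0 := by simp [hzero.fderiv_eq]
      simp [divVF, vfApply, hfderiv, hzero.eq_of_nhds]
  · intro h Y Z hY hZ p
    have hdefect := vfApply_mul_gst2_sub (hlam' p) (hne p) (hX' p)
      (hY.differentiable (by simp) p) (hZ.differentiable (by simp) p)
    rw [h p, mul_zero, zero_mul] at hdefect
    exact sub_eq_zero.mp hdefect
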